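/- Let F_q be a finite field and let α_1, α_2 be distinct nonzero elements of F_q satisfying α_1² + α_1·α_2 − α_2² ≠ 0, α_2² + α_1·α_2 − α_1² ≠ 0, and α_1² − 3·α_1·α_2 + α_2² ≠ 0. Then the L_q^2-TD contains no (5,4) absorbing set configuration: there do not exist five pairwise distinct blocks B_1, …, B_5 such that B_2 ∩ B_5 = ∅, B_3 ∩ B_4 = ∅, each of the remaining eight pairs of blocks intersects in exactly one point, and these eight intersection points are pairwise distinct. -/

import Mathlib

/-- The block `B(x,y)` of the `𝓛_q^2`-TD with scale factors `α₁, α₂`: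
`B(x,y) = {(x,1), (y,2), (α₁·x+y,3), (α₂·x+y,4)}`, the four groups being indexed
by `Fin 4`. -/
def blk4 {F : Type*} [Field F] (α₁ α₂ : F) (xy : F × F) : Set (F × Fin 4) :=
  {(xy.1, (0 : Fin 4)), (xy.2, (1 : Fin 4)),
   (α₁ * xy.1 + xy.2, (2 : Fin 4)), (α₂ * xy.1 + xy.2, (3 : Fin 4))}

/-- In the `(5,4)` configuration the pairs `{B₂, B₅}` (indices `{1,4}`) and `{B₃, B₄}`
(indices `{2,3}`) are the two non-intersecting pairs; all other pairs of blocks meet. -/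
def meetingPair (i j : Fin 5) : Prop :=
  ¬((i = 1 ∧ j = 4) ∨ (i = 4 ∧ j = 1) ∨ (i = 2 ∧ j = 3) ∨ (i = 3 ∧ j = 2))

/-- Coefficients of the linear form giving the coordinate of a block in each group. -/
def groupCoeff {F : Type*} [Field F] (α₁ α₂ : F) : Fin 4 → F × F :=
  ![(1, 0), (0, 1), (α₁, 1), (α₂, 1)]

/-- The coordinate in group `k` of the point of the block with parameters `v`. -/
def groupForm {F : Type*} [Field F] (α₁ α₂ : F) (k : Fin 4) (v : F × F) : F :=
  (groupCoeff α₁ α₂ k).1 * v.1 + (groupCoeff α₁ α₂ k).2 * v.2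

/-- The determinant of two of the linear forms `groupForm`. -/
def groupDet {F : Type*} [Field F] (α₁ α₂ : F) (k l : Fin 4) : F :=
  (groupCoeff α₁ α₂ k).1 * (groupCoeff α₁ α₂ l).2 -
    (groupCoeff α₁ α₂ l).1 * (groupCoeff α₁ α₂ k).2

theorem mem_blk4_iff {F : Type*} [Field F] (α₁ α₂ : F) (v : F × F) (p : F × Fin 4) :
    p ∈ blk4 α₁ α₂ v ↔ p.1 = groupForm α₁ α₂ p.2 v := by
  obtain ⟨x, k⟩ := p
  fin_cases k <;> simp [blk4, groupForm, groupCoeff]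

theorem groupDet_ne_zero {F : Type*} [Field F] {α₁ α₂ : F} (hα₁ : α₁ ≠ 0) (hα₂ : α₂ ≠ 0)
    (hne : α₁ ≠ α₂) {k l : Fin 4} (hkl : k ≠ l) : groupDet α₁ α₂ k l ≠ 0 := by
  have h₁ := sub_ne_zero.2 hne
  have h₂ := sub_ne_zero.2 hne.symm
  fin_cases k <;> fin_cases l <;> simp_all [groupDet, groupCoeff]

theorem groupForm_injective_pair {F : Type*} [Field F] {α₁ α₂ : F} (hα₁ : α₁ ≠ 0)
    (hα₂ : α₂ ≠ 0) (hne : α₁ ≠ α₂) {k l : Fin 4} (hkl : k ≠ l) {v w : F × F}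
    (hk : groupForm α₁ α₂ k v = groupForm α₁ α₂ k w)
    (hl : groupForm α₁ α₂ l v = groupForm α₁ α₂ l w) : v = w := by
  have hdet := groupDet_ne_zero hα₁ hα₂ hne hkl
  unfold groupForm at hk hl
  unfold groupDet at hdet
  refine Prod.ext (mul_left_cancel₀ hdet ?_) (mul_left_cancel₀ hdet ?_)
  · linear_combination (groupCoeff α₁ α₂ l).2 * hk - (groupCoeff α₁ α₂ k).2 * hl
  · linear_combination (groupCoeff α₁ α₂ k).1 * hl - (groupCoeff α₁ α₂ l).1 * hk

/-- Two blocks meeting in group `a` have coordinate differences in groups `k`, `l`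
proportional to the determinants with `a`. -/
theorem groupDet_mul_groupForm_sub {F : Type*} [Field F] {α₁ α₂ : F} {a : Fin 4}
    (k l : Fin 4) {v w : F × F} (h : groupForm α₁ α₂ a v = groupForm α₁ α₂ a w) :
    groupDet α₁ α₂ a l * (groupForm α₁ α₂ k v - groupForm α₁ α₂ k w) =
      groupDet α₁ α₂ a k * (groupForm α₁ α₂ l v - groupForm α₁ α₂ l w) := by
  unfold groupForm at *
  unfold groupDet
  linear_combination ((groupCoeff α₁ α₂ k).1 * (groupCoeff α₁ α₂ l).2 -
    (groupCoeff α₁ α₂ l).1 * (groupCoeff α₁ α₂ k).2) * h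

theorem groupDet_sq_ne {F : Type*} [Field F] {α₁ α₂ : F}
    (hC5 : α₁ ^ 2 + α₁ * α₂ - α₂ ^ 2 ≠ 0)
    (hC6 : α₂ ^ 2 + α₁ * α₂ - α₁ ^ 2 ≠ 0)
    (hC7 : α₁ ^ 2 - 3 * α₁ * α₂ + α₂ ^ 2 ≠ 0) {a b c d : Fin 4}
    (hab : a ≠ b) (hac : a ≠ c) (had : a ≠ d) (hbc : b ≠ c) (hbd : b ≠ d) (hcd : c ≠ d) :
    (groupDet α₁ α₂ a d * groupDet α₁ α₂ b c) ^ 2 ≠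
      groupDet α₁ α₂ a b * groupDet α₁ α₂ c d *
        (groupDet α₁ α₂ a c * groupDet α₁ α₂ b d) := by
  intro h
  fin_cases a <;> fin_cases b <;> first | exact hab rfl | skip
  all_goals fin_cases c <;> first | exact hac rfl | exact hbc rfl | skip
  all_goals fin_cases d <;> first | exact had rfl | exact hbd rfl | exact hcd rfl | skip
  all_goals
    simp only [groupDet, groupCoeff] at h
    simp at h
    first
    | exact hC5 (by linear_combination h)
    | exact hC5 (by linear_combination -h)
    | exact hC6 (by linear_combination h)
    | exact hC6 (by linear_combination -h)
    | exact hC7 (by linear_combination h)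

/-- There is no wheel of blocks with hub `v₀` and rim `v₁, v₂, v₄, v₃` whose spokes lie in the
groups `a, b, d, c` and whose rim edges lie in the groups `c, a, b, d`. -/
theorem not_exists_wheel {F : Type*} [Field F] {α₁ α₂ : F}
    (hα₁ : α₁ ≠ 0) (hα₂ : α₂ ≠ 0) (hne : α₁ ≠ α₂)
    (hC5 : α₁ ^ 2 + α₁ * α₂ - α₂ ^ 2 ≠ 0)
    (hC6 : α₂ ^ 2 + α₁ * α₂ - α₁ ^ 2 ≠ 0)
    (hC7 : α₁ ^ 2 - 3 * α₁ * α₂ + α₂ ^ 2 ≠ 0) {a b c d : Fin 4}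
    (hab : a ≠ b) (hac : a ≠ c) (had : a ≠ d) (hbc : b ≠ c) (hbd : b ≠ d) (hcd : c ≠ d)
    {v₀ v₁ v₂ v₃ v₄ : F × F} (h₀₁ : v₀ ≠ v₁)
    (ha : groupForm α₁ α₂ a v₀ = groupForm α₁ α₂ a v₁)
    (hb : groupForm α₁ α₂ b v₀ = groupForm α₁ α₂ b v₂)
    (hc : groupForm α₁ α₂ c v₀ = groupForm α₁ α₂ c v₃)
    (hd : groupForm α₁ α₂ d v₀ = groupForm α₁ α₂ d v₄)
    (h₁₂ : groupForm α₁ α₂ c v₁ = groupForm α₁ α₂ c v₂)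
    (h₂₄ : groupForm α₁ α₂ a v₂ = groupForm α₁ α₂ a v₄)
    (h₃₄ : groupForm α₁ α₂ b v₃ = groupForm α₁ α₂ b v₄)
    (h₁₃ : groupForm α₁ α₂ d v₁ = groupForm α₁ α₂ d v₃) : False := by
  have e₁ := groupDet_mul_groupForm_sub c d ha
  have e₂ := groupDet_mul_groupForm_sub a c hb
  have e₃ := groupDet_mul_groupForm_sub d b hc
  have e₄ := groupDet_mul_groupForm_sub b a hd
  rw [← h₁₂] at e₂
  rw [← h₁₃, h₃₄] at e₃
  rw [← h₂₄] at e₄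
  have hanti (k l : Fin 4) : groupDet α₁ α₂ k l = -groupDet α₁ α₂ l k := by
    unfold groupDet; ring
  rw [hanti b a] at e₂
  rw [hanti c b] at e₃
  rw [hanti d a, hanti d b] at e₄
  have hw : groupForm α₁ α₂ d v₀ - groupForm α₁ α₂ d v₁ ≠ 0 := fun h =>
    h₀₁ (groupForm_injective_pair hα₁ hα₂ hne had ha (sub_eq_zero.1 h))
  refine groupDet_sq_ne hC5 hC6 hC7 hab hac had hbc hbd hcd (mul_right_cancel₀ hw ?_)
  generalize groupForm α₁ α₂ d v₀ - groupForm α₁ α₂ d v₁ = w at *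
  generalize groupForm α₁ α₂ c v₀ - groupForm α₁ α₂ c v₁ = s at *
  generalize groupForm α₁ α₂ a v₀ - groupForm α₁ α₂ a v₂ = t at *
  generalize groupForm α₁ α₂ b v₀ - groupForm α₁ α₂ b v₄ = u at *
  generalize groupDet α₁ α₂ a b = ab at *
  generalize groupDet α₁ α₂ a c = ac at *
  generalize groupDet α₁ α₂ a d = ad at *
  generalize groupDet α₁ α₂ b c = bc at *
  generalize groupDet α₁ α₂ b d = bd at *
  generalize groupDet α₁ α₂ c d = cd at *
  linear_combination ab * bd * cd * e₁ - ad * bd * cd * e₂ - ad ^ 2 * bc * e₃ + ad * bc * cd * e₄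

theorem fin_four_eq_or_eq {a b c d k : Fin 4} (hab : a ≠ b) (hac : a ≠ c) (had : a ≠ d)
    (hbc : b ≠ c) (hbd : b ≠ d) (hcd : c ≠ d) (ha : k ≠ a) (hb : k ≠ b) :
    k = c ∨ k = d := by
  omega

/-- If `α₁² + α₁·α₂ − α₂² ≠ 0`, `α₂² + α₁·α₂ − α₁² ≠ 0` and
`α₁² − 3·α₁·α₂ + α₂² ≠ 0`, then the `𝓛_q^2`-TD contains no `(5,4)` absorbing set
configuration: there are no five pairwise distinct blocks `B₁,…,B₅` with
`B₂ ∩ B₅ = ∅`, `B₃ ∩ B₄ = ∅`, each of the remaining eight pairs of blocks meeting in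
exactly one point, and those eight intersection points pairwise distinct. -/
theorem ltd2_no_54_absorbing_set {F : Type*} [Field F] [Fintype F]
    (α₁ α₂ : F) (hα₁ : α₁ ≠ 0) (hα₂ : α₂ ≠ 0) (hne : α₁ ≠ α₂)
    (hC5 : α₁ ^ 2 + α₁ * α₂ - α₂ ^ 2 ≠ 0)
    (hC6 : α₂ ^ 2 + α₁ * α₂ - α₁ ^ 2 ≠ 0)
    (hC7 : α₁ ^ 2 - 3 * α₁ * α₂ + α₂ ^ 2 ≠ 0) :
    ¬ ∃ (b : Fin 5 → F × F) (pt : Fin 5 → Fin 5 → F × Fin 4),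
        Function.Injective b ∧
        blk4 α₁ α₂ (b 1) ∩ blk4 α₁ α₂ (b 4) = ∅ ∧
        blk4 α₁ α₂ (b 2) ∩ blk4 α₁ α₂ (b 3) = ∅ ∧
        (∀ i j : Fin 5, i ≠ j → meetingPair i j →
            blk4 α₁ α₂ (b i) ∩ blk4 α₁ α₂ (b j) = {pt i j}) ∧
        (∀ i j k l : Fin 5, i < j → k < l → meetingPair i j → meetingPair k l →
            (i, j) ≠ (k, l) → pt i j ≠ pt k l) := by
  rintro ⟨b, pt, hinj, -, -, hmeet, hdist⟩
  have hpt (i j : Fin 5) (hij : i < j) (hm : meetingPair i j) :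
      (pt i j).1 = groupForm α₁ α₂ (pt i j).2 (b i) ∧
        (pt i j).1 = groupForm α₁ α₂ (pt i j).2 (b j) := by
    have h : pt i j ∈ blk4 α₁ α₂ (b i) ∩ blk4 α₁ α₂ (b j) := by
      rw [hmeet i j hij.ne hm]
      rfl
    exact ⟨(mem_blk4_iff ..).1 h.1, (mem_blk4_iff ..).1 h.2⟩
  have heq (i j : Fin 5) (hij : i < j) (hm : meetingPair i j) :
      groupForm α₁ α₂ (pt i j).2 (b i) = groupForm α₁ α₂ (pt i j).2 (b j) :=
    (hpt i j hij hm).1.symm.trans (hpt i j hij hm).2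
  have hcol (i j k l : Fin 5) (hij : i < j := by decide) (hkl : k < l := by decide)
      (hm : meetingPair i j := by unfold meetingPair; decide)
      (hm' : meetingPair k l := by unfold meetingPair; decide)
      (hn : (i, j) ≠ (k, l) := by decide)
      (hs : i = k ∨ i = l ∨ j = k ∨ j = l := by decide) :
      (pt i j).2 ≠ (pt k l).2 := by
    intro h
    refine hdist i j k l hij hkl hm hm' hn (Prod.ext ?_ h)
    obtain ⟨h₁, h₂⟩ := hpt i j hij hm
    obtain ⟨h₃, h₄⟩ := hpt k l hkl hm'
    rw [← h] at h₃ h₄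
    rcases hs with rfl | rfl | rfl | rfl
    · exact h₁.trans h₃.symm
    · exact h₁.trans h₄.symm
    · exact h₂.trans h₃.symm
    · exact h₂.trans h₄.symm
  unfold meetingPair at heq
  have hab := hcol 0 1 0 2
  have hac := hcol 0 1 0 3
  have had := hcol 0 1 0 4
  have hbc := hcol 0 2 0 3
  have hbd := hcol 0 2 0 4
  have hcd := hcol 0 3 0 4
  have n12a := hcol 1 2 0 1
  have n12b := hcol 1 2 0 2
  have n13a := hcol 1 3 0 1
  have n13c := hcol 1 3 0 3
  have n24b := hcol 2 4 0 2
  have n24d := hcol 2 4 0 4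
  have n34c := hcol 3 4 0 3
  have n34d := hcol 3 4 0 4
  have n1224 := hcol 1 2 2 4
  have n2434 := hcol 2 4 3 4
  have n3413 := hcol 3 4 1 3
  have n1312 := hcol 1 3 1 2
  have e01 := heq 0 1 (by decide) (by decide)
  have e02 := heq 0 2 (by decide) (by decide)
  have e03 := heq 0 3 (by decide) (by decide)
  have e04 := heq 0 4 (by decide) (by decide)
  have e12 := heq 1 2 (by decide) (by decide)
  have e13 := heq 1 3 (by decide) (by decide)
  have e24 := heq 2 4 (by decide) (by decide)
  have e34 := heq 3 4 (by decide) (by decide)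
  have h₀₁ : b 0 ≠ b 1 := hinj.ne (by decide)
  have c12 := fin_four_eq_or_eq hab hac had hbc hbd hcd n12a n12b
  have c13 := fin_four_eq_or_eq hac hab had hbc.symm hcd hbd n13a n13c
  have c24 := fin_four_eq_or_eq hbd hab.symm hbc had.symm hcd.symm hac n24b n24d
  have c34 := fin_four_eq_or_eq hcd hac.symm hbc.symm had.symm hbd.symm hab n34c n34d
  rcases c12 with h12 | h12
  · have h24 := c24.resolve_right fun h => n1224 (h12.trans h.symm)
    have h34 := c34.resolve_left fun h => n2434 (h24.trans h.symm)
    have h13 := c13.resolve_left fun h => n3413 (h34.trans h.symm)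
    rw [h12] at e12
    rw [h24] at e24
    rw [h34] at e34
    rw [h13] at e13
    exact not_exists_wheel hα₁ hα₂ hne hC5 hC6 hC7 hab hac had hbc hbd hcd h₀₁
      e01 e02 e03 e04 e12 e24 e34 e13
  · have h13 := c13.resolve_right fun h => n1312 (h.trans h12.symm)
    have h34 := c34.resolve_right fun h => n3413 (h.trans h13.symm)
    have h24 := c24.resolve_left fun h => n2434 (h.trans h34.symm)
    rw [h12] at e12
    rw [h24] at e24
    rw [h34] at e34
    rw [h13] at e13
    exact not_exists_wheel hα₁ hα₂ hne hC5 hC6 hC7 hac hab had hbc.symm hcd hbd h₀₁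
      e01 e03 e02 e04 e13 e34 e24 e12
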